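/- arXiv:2511.19819 — 3 statements merged into one kernel-verified Lean document; each statement's English description precedes it below -/
import Mathlib

section
/- Let N ≥ 1, let k₁,…,k_N be nonzero real constants, and let u, v : ℝ^N → ℝ be C^∞ functions. Then □²(u·v) = Σ_{α=0}^{2} C(2,α)·(□^{2−α}u)·(□^α v) + 4·[◊(□u, v) + ◊(u, □v)] + 4·◊²(u,v), where □² denotes □ applied twice and C(n,α) is the binomial coefficient. -/
variable {N : ℕ}

/-- Partial derivative in the `i`-th coordinate direction. -/
noncomputable def pd (i : Fin N) (f : (Fin N → ℝ) → ℝ) : (Fin N → ℝ) → ℝ :=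
  fun x => fderiv ℝ f x (Pi.single i 1)

/-- Iterated partial derivative along a list of coordinate directions. -/
noncomputable def mpd : List (Fin N) → ((Fin N → ℝ) → ℝ) → ((Fin N → ℝ) → ℝ)
  | [], f => f
  | i :: l, f => pd i (mpd l f)

/-- The operator `□w = Σ_{i=1}^N (1/k_i) ∂²w/∂x_i²`. -/
noncomputable def box (k : Fin N → ℝ) (f : (Fin N → ℝ) → ℝ) : (Fin N → ℝ) → ℝ :=
  fun x => ∑ i : Fin N, (1 / k i) * pd i (pd i f) x

/-- The bilinear operator
`◊^m(u,v) = Σ_{i₁,…,i_m} (1/(k_{i₁}⋯k_{i_m})) (∂^m u/∂x_{i₁}⋯∂x_{i_m})·(∂^m v/∂x_{i₁}⋯∂x_{i_m})`. -/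
noncomputable def diam (k : Fin N → ℝ) (m : ℕ) (u v : (Fin N → ℝ) → ℝ) :
    (Fin N → ℝ) → ℝ :=
  fun x => ∑ ι : Fin m → Fin N,
    (∏ j : Fin m, 1 / k (ι j)) * mpd (List.ofFn ι) u x * mpd (List.ofFn ι) v x

section

variable {k : Fin N → ℝ} {f g : (Fin N → ℝ) → ℝ} {i : Fin N}

theorem ContDiff.pd (hf : ContDiff ℝ (⊤ : ℕ∞) f) (i : Fin N) :
    ContDiff ℝ (⊤ : ℕ∞) (pd i f) :=
  (hf.fderiv_right (m := (⊤ : ℕ∞)) (by simp)).clm_apply contDiff_const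

theorem ContDiff.box (hf : ContDiff ℝ (⊤ : ℕ∞) f) (k : Fin N → ℝ) :
    ContDiff ℝ (⊤ : ℕ∞) (box k f) :=
  ContDiff.sum fun i _ => contDiff_const.mul ((hf.pd i).pd i)

theorem ContDiff.differentiable_of_top (hf : ContDiff ℝ (⊤ : ℕ∞) f) : Differentiable ℝ f :=
  hf.differentiable (by simp)

theorem pd_add (hf : Differentiable ℝ f) (hg : Differentiable ℝ g) :
    pd i (f + g) = pd i f + pd i g := by
  funext x
  simp [pd, fderiv_add (hf x) (hg x)]

theorem pd_mul (hf : Differentiable ℝ f) (hg : Differentiable ℝ g) :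
    pd i (f * g) = pd i f * g + f * pd i g := by
  funext x
  simp only [pd, fderiv_mul (hf x) (hg x), add_apply, smul_apply,
    smul_eq_mul, Pi.add_apply, Pi.mul_apply]
  ring

theorem pd_const_smul (c : ℝ) (hf : Differentiable ℝ f) : pd i (c • f) = c • pd i f := by
  funext x
  simp [pd, fderiv_const_smul (hf x) c]

theorem pd_sum {ι : Type*} (s : Finset ι) {F : ι → (Fin N → ℝ) → ℝ}
    (hF : ∀ a ∈ s, Differentiable ℝ (F a)) :
    pd i (∑ a ∈ s, F a) = ∑ a ∈ s, pd i (F a) := by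
  funext x
  simp [pd, fderiv_sum fun a ha => hF a ha x]

theorem pd_comm (hf : ContDiff ℝ (⊤ : ℕ∞) f) (i j : Fin N) :
    pd i (pd j f) = pd j (pd i f) := by
  have hd : Differentiable ℝ (fderiv ℝ f) :=
    (hf.fderiv_right (m := (⊤ : ℕ∞)) (by simp)).differentiable (by simp)
  have second (a b : Fin N) (x : Fin N → ℝ) :
      pd a (pd b f) x = fderiv ℝ (fderiv ℝ f) x (Pi.single a 1) (Pi.single b 1) := by
    change fderiv ℝ (fun y => fderiv ℝ f y (Pi.single b 1)) x (Pi.single a 1) = _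
    rw [fderiv_clm_apply (hd x) (differentiableAt_const _)]
    simp
  funext x
  rw [second, second]
  exact (hf.contDiffAt.isSymmSndFDerivAt
    (by rw [minSmoothness_of_isRCLikeNormedField]; exact WithTop.coe_le_coe.2 le_top)).eq _ _

theorem box_eq_sum (k : Fin N → ℝ) (f : (Fin N → ℝ) → ℝ) :
    box k f = ∑ i, (1 / k i) • pd i (pd i f) := by
  funext x
  simp [box]

theorem box_add (hf : ContDiff ℝ (⊤ : ℕ∞) f) (hg : ContDiff ℝ (⊤ : ℕ∞) g) :
    box k (f + g) = box k f + box k g := by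
  simp only [box_eq_sum, ← Finset.sum_add_distrib, ← smul_add]
  refine Finset.sum_congr rfl fun i _ => ?_
  rw [pd_add hf.differentiable_of_top hg.differentiable_of_top,
    pd_add (hf.pd i).differentiable_of_top (hg.pd i).differentiable_of_top]

theorem box_const_smul (c : ℝ) (hf : ContDiff ℝ (⊤ : ℕ∞) f) :
    box k (c • f) = c • box k f := by
  simp only [box_eq_sum, Finset.smul_sum]
  refine Finset.sum_congr rfl fun i _ => ?_
  rw [pd_const_smul c hf.differentiable_of_top,
    pd_const_smul c (hf.pd i).differentiable_of_top, smul_comm]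

theorem box_sum {ι : Type*} (s : Finset ι) {F : ι → (Fin N → ℝ) → ℝ}
    (hF : ∀ a ∈ s, ContDiff ℝ (⊤ : ℕ∞) (F a)) :
    box k (∑ a ∈ s, F a) = ∑ a ∈ s, box k (F a) := by
  simp only [box_eq_sum]
  rw [Finset.sum_comm]
  refine Finset.sum_congr rfl fun i _ => ?_
  rw [pd_sum s fun a ha => (hF a ha).differentiable_of_top,
    pd_sum s fun a ha => ((hF a ha).pd i).differentiable_of_top, Finset.smul_sum]

theorem box_pd (hf : ContDiff ℝ (⊤ : ℕ∞) f) (i : Fin N) :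
    box k (pd i f) = pd i (box k f) := by
  rw [box_eq_sum, box_eq_sum, pd_sum _ fun j _ =>
    (((hf.pd j).pd j).differentiable_of_top.const_smul (1 / k j))]
  refine Finset.sum_congr rfl fun j _ => ?_
  rw [pd_const_smul _ ((hf.pd j).pd j).differentiable_of_top, pd_comm hf j i,
    pd_comm (hf.pd j) j i]

theorem diam_one (k : Fin N → ℝ) (f g : (Fin N → ℝ) → ℝ) :
    diam k 1 f g = ∑ i, (1 / k i) • (pd i f * pd i g) := by
  funext x
  rw [diam, ← (Equiv.funUnique (Fin 1) (Fin N)).symm.sum_comp]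
  simp [mpd, mul_assoc]

theorem diam_two (k : Fin N → ℝ) (f g : (Fin N → ℝ) → ℝ) :
    diam k 2 f g = ∑ i, (1 / k i) • ∑ j, (1 / k j) • (pd i (pd j f) * pd i (pd j g)) := by
  funext x
  rw [diam, ← (finTwoArrowEquiv (Fin N)).symm.sum_comp, Fintype.sum_prod_type]
  simp only [Finset.sum_apply, Pi.smul_apply, Pi.mul_apply, smul_eq_mul, Finset.mul_sum]
  refine Finset.sum_congr rfl fun i _ => Finset.sum_congr rfl fun j _ => ?_
  simp [mpd]
  ring

theorem box_mul (hf : ContDiff ℝ (⊤ : ℕ∞) f) (hg : ContDiff ℝ (⊤ : ℕ∞) g) :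
    box k (f * g) = box k f * g + (2 : ℝ) • diam k 1 f g + f * box k g := by
  simp only [box_eq_sum, diam_one, Finset.sum_mul, Finset.mul_sum, Finset.smul_sum,
    ← Finset.sum_add_distrib]
  refine Finset.sum_congr rfl fun i _ => ?_
  have hf' := hf.differentiable_of_top
  have hg' := hg.differentiable_of_top
  have hfi := (hf.pd i).differentiable_of_top
  have hgi := (hg.pd i).differentiable_of_top
  rw [pd_mul hf' hg', pd_add (hfi.mul hg') (hf'.mul hgi), pd_mul hfi hg', pd_mul hf' hgi]
  funext x
  simp only [Pi.add_apply, Pi.mul_apply, Pi.smul_apply, smul_eq_mul]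
  ring

theorem ContDiff.diam_one (hf : ContDiff ℝ (⊤ : ℕ∞) f) (hg : ContDiff ℝ (⊤ : ℕ∞) g) :
    ContDiff ℝ (⊤ : ℕ∞) (diam k 1 f g) := by
  rw [_root_.diam_one]
  rw [Finset.sum_fn]
  exact ContDiff.sum fun i _ => ((hf.pd i).mul (hg.pd i)).const_smul (1 / k i)

theorem box_diam_one (hf : ContDiff ℝ (⊤ : ℕ∞) f) (hg : ContDiff ℝ (⊤ : ℕ∞) g) :
    box k (diam k 1 f g) =
      diam k 1 (box k f) g + (2 : ℝ) • diam k 2 f g + diam k 1 f (box k g) := by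
  have hfg (i : Fin N) : ContDiff ℝ (⊤ : ℕ∞) (pd i f * pd i g) := (hf.pd i).mul (hg.pd i)
  have h₂ : diam k 2 f g = ∑ i, (1 / k i) • diam k 1 (pd i f) (pd i g) := by
    simp only [diam_two, diam_one]
    refine Finset.sum_congr rfl fun i _ => ?_
    simp only [pd_comm hf i, pd_comm hg i]
  rw [h₂, diam_one k f g, box_sum (F := fun i => (1 / k i) • (pd i f * pd i g)) _
    fun i _ => (hfg i).const_smul (1 / k i),
    diam_one k (box k f), diam_one k f, Finset.smul_sum, ← Finset.sum_add_distrib,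
    ← Finset.sum_add_distrib]
  refine Finset.sum_congr rfl fun i _ => ?_
  rw [box_const_smul _ (hfg i), box_mul (hf.pd i) (hg.pd i), box_pd hf, box_pd hg, smul_add,
    smul_add, smul_comm (2 : ℝ)]

end

/-- Second formula of Proposition 2.2:
`□²(uv) = Σ_{α=0}^{2} C(2,α)(□^{2−α}u)(□^α v) + 4[◊(□u,v) + ◊(u,□v)] + 4◊²(u,v)`. -/
theorem box_sq_mul (hN : 1 ≤ N) (k : Fin N → ℝ) (hk : ∀ i, k i ≠ 0)
    (u v : (Fin N → ℝ) → ℝ) (hu : ContDiff ℝ (⊤ : ℕ∞) u) (hv : ContDiff ℝ (⊤ : ℕ∞) v) :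
    (box k)^[2] (fun x => u x * v x) =
      fun x =>
        (∑ α ∈ Finset.range 3,
          (Nat.choose 2 α : ℝ) * (box k)^[2 - α] u x * (box k)^[α] v x) +
        4 * (diam k 1 (box k u) v x + diam k 1 u (box k v) x) +
        4 * diam k 2 u v x := by
  have hd : ContDiff ℝ (⊤ : ℕ∞) ((2 : ℝ) • diam k 1 u v) :=
    (hu.diam_one hv).const_smul (2 : ℝ)
  have h₁ : ContDiff ℝ (⊤ : ℕ∞) (box k u * v) := (hu.box k).mul hv
  have h₂ : ContDiff ℝ (⊤ : ℕ∞) (u * box k v) := hu.mul (hv.box k)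
  have h₃ : ContDiff ℝ (⊤ : ℕ∞) (box k u * v + (2 : ℝ) • diam k 1 u v) := h₁.add hd
  change box k (box k (u * v)) = _
  rw [box_mul hu hv, box_add h₃ h₂, box_add h₁ hd, box_const_smul _ (hu.diam_one hv),
    box_mul (hu.box k) hv, box_mul hu (hv.box k), box_diam_one hu hv]
  funext x
  simp [Finset.sum_range_succ]
  ring
end

section
/- Let k₁ ≠ 0 and t be real numbers, let g : ℝ → ℝ be a C⁶ function with g(0) = g'(0) = g''(0) = 0, and let δ : ℝ → ℝ be a C⁶ function with δ(0) = 1, δ'(0) = 0, and δ''(0) = k₁². Set ψ(x) = δ(x)·e^{tx}. Then (1/2)·(1/k₁)·ψ''(0) + (1/8)·(1/k₁²)·(g·ψ)⁗(0) + (1/96)·(1/k₁³)·(g²·ψ)⁽⁶⁾(0) = (1/2)·(t²/k₁ + k₁) + (1/(8k₁²))·(g⁗(0) + 4t·g'''(0)) + (20/(96·k₁³))·(g'''(0))². -/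
/-- Explicit evaluation of the first-order stationary-phase coefficient `L₁ψ`
(up to the factor `−i`) in the proof of Lemma 3.1, where `ψ(x) = δ(x)e^{tx}`. -/
theorem L1_coefficient_evaluation (k₁ t : ℝ) (hk₁ : k₁ ≠ 0) (g δ : ℝ → ℝ)
    (hg : ContDiff ℝ 6 g) (hg0 : g 0 = 0) (hg1 : iteratedDeriv 1 g 0 = 0)
    (hg2 : iteratedDeriv 2 g 0 = 0)
    (hδ : ContDiff ℝ 6 δ) (hδ0 : δ 0 = 1) (hδ1 : iteratedDeriv 1 δ 0 = 0)
    (hδ2 : iteratedDeriv 2 δ 0 = k₁ ^ 2) :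
    (1 / 2) * (1 / k₁) *
        iteratedDeriv 2 (fun x => δ x * Real.exp (t * x)) 0 +
      (1 / 8) * (1 / k₁ ^ 2) *
        iteratedDeriv 4 (fun x => g x * (δ x * Real.exp (t * x))) 0 +
      (1 / 96) * (1 / k₁ ^ 3) *
        iteratedDeriv 6 (fun x => (g x) ^ 2 * (δ x * Real.exp (t * x))) 0 =
    (1 / 2) * (t ^ 2 / k₁ + k₁) +
      (1 / (8 * k₁ ^ 2)) * (iteratedDeriv 4 g 0 + 4 * t * iteratedDeriv 3 g 0) +
      (20 / (96 * k₁ ^ 3)) * (iteratedDeriv 3 g 0) ^ 2 := by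
  have hE : ContDiff ℝ 6 (fun x => Real.exp (t * x)) := by fun_prop
  have hψ : ContDiff ℝ 6 (fun x => δ x * Real.exp (t * x)) := hδ.mul hE
  have hψ1 : iteratedDeriv 1 (fun x => δ x * Real.exp (t * x)) 0 = t := by
    rw [iteratedDeriv_fun_mul (hδ.contDiffAt.of_le (by norm_num))
      (hE.contDiffAt.of_le (by norm_num))]
    simp only [Finset.sum_range_succ, Finset.sum_range_zero, iteratedDeriv_exp_const_mul, hδ1,
      iteratedDeriv_zero, hδ0]
    simp
  have hψ2 : iteratedDeriv 2 (fun x => δ x * Real.exp (t * x)) 0 = t ^ 2 + k₁ ^ 2 := by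
    rw [iteratedDeriv_fun_mul (hδ.contDiffAt.of_le (by norm_num))
      (hE.contDiffAt.of_le (by norm_num))]
    simp only [Finset.sum_range_succ, Finset.sum_range_zero, iteratedDeriv_exp_const_mul, hδ1,
      hδ2, iteratedDeriv_zero, hδ0]
    simp
  have hgψ : iteratedDeriv 4 (fun x => g x * (δ x * Real.exp (t * x))) 0 =
      iteratedDeriv 4 g 0 + 4 * t * iteratedDeriv 3 g 0 := by
    rw [iteratedDeriv_fun_mul (hg.contDiffAt.of_le (by norm_num))
      (hψ.contDiffAt.of_le (by norm_num))]
    simp only [Finset.sum_range_succ, Finset.sum_range_zero, hg1, hg2, iteratedDeriv_zero, hg0,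
      Nat.reduceSub, hδ0, hψ1]
    norm_num [Nat.choose]
    ring
  have hsq (n : ℕ) (hn : n ≤ 6) : iteratedDeriv n (fun x => g x ^ 2) 0 =
      if n = 6 then 20 * iteratedDeriv 3 g 0 ^ 2 else 0 := by
    have hgn : ContDiffAt ℝ n g 0 := hg.contDiffAt.of_le (by exact_mod_cast hn)
    simp only [pow_two]
    rw [iteratedDeriv_fun_mul hgn hgn]
    interval_cases n <;>
      simp [Finset.sum_range_succ, hg0, hg1, hg2, Nat.choose, -iteratedDeriv_one]
    ring
  have hg2ψ : iteratedDeriv 6 (fun x => (g x) ^ 2 * (δ x * Real.exp (t * x))) 0 =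
      20 * iteratedDeriv 3 g 0 ^ 2 := by
    rw [iteratedDeriv_fun_mul (hg.pow 2).contDiffAt hψ.contDiffAt]
    simp [Finset.sum_range_succ, hsq, hδ0, -iteratedDeriv_one]
  rw [hψ2, hgψ, hg2ψ]
  field_simp
end

section
/- Let K be a compact convex subset of ℝ² (EuclideanSpace ℝ (Fin 2)) with nonempty interior that is centrally symmetric about the origin (x ∈ K ↔ −x ∈ K), and let L > 0. Suppose K has constant width L: for every unit vector ν ∈ ℝ², sSup {⟪x, ν⟫ : x ∈ K} − sInf {⟪x, ν⟫ : x ∈ K} = L. Then K is the closed disk of radius L/2 centered at the origin: K = Metric.closedBall 0 (L/2). -/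
open scoped RealInnerProductSpace

section SupportFunction

variable {E : Type*} [NormedAddCommGroup E] [InnerProductSpace ℝ E] {K : Set E}

/-- The support function of a nonempty compact centrally symmetric set is half its width. -/
theorem IsCompact.isGreatest_inner_half_width (hcpt : IsCompact K) (hne : K.Nonempty)
    (hsym : ∀ x, x ∈ K ↔ -x ∈ K) (v : E) :
    IsGreatest ((fun x => ⟪x, v⟫) '' K)
      ((sSup ((fun x => ⟪x, v⟫) '' K) - sInf ((fun x => ⟪x, v⟫) '' K)) / 2) := by
  obtain ⟨m, hm, hmax⟩ := hcpt.exists_isMaxOn hne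
    (f := fun x => ⟪x, v⟫) (by fun_prop)
  have hgreatest : IsGreatest ((fun x => ⟪x, v⟫) '' K) ⟪m, v⟫ :=
    ⟨⟨m, hm, rfl⟩, by rintro _ ⟨x, hx, rfl⟩; exact hmax hx⟩
  have hleast : IsLeast ((fun x => ⟪x, v⟫) '' K) (-⟪m, v⟫) := by
    refine ⟨⟨-m, (hsym m).1 hm, inner_neg_left _ _⟩, ?_⟩
    rintro _ ⟨x, hx, rfl⟩
    have h : ⟪-x, v⟫ ≤ ⟪m, v⟫ := hmax ((hsym x).1 hx)
    rw [inner_neg_left] at h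
    exact neg_le.1 h
  rw [hgreatest.csSup_eq, hleast.csInf_eq, sub_neg_eq_add, add_self_div_two]
  exact hgreatest

/-- A closed convex set whose support function is `r` on the unit sphere is the closed ball of
radius `r` around the origin. -/
theorem Convex.eq_closedBall_of_isGreatest_inner [CompleteSpace E] (hconv : Convex ℝ K)
    (hclosed : IsClosed K) (hne : K.Nonempty) {r : ℝ} (hr : 0 ≤ r)
    (h : ∀ v : E, ‖v‖ = 1 → IsGreatest ((fun x => ⟪x, v⟫) '' K) r) :
    K = Metric.closedBall 0 r := by
  ext x
  rw [mem_closedBall_zero_iff]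
  constructor
  · intro hx
    rcases eq_or_ne x 0 with rfl | hx0
    · simpa using hr
    have hle := (h (‖x‖⁻¹ • x) (norm_smul_inv_norm (𝕜 := ℝ) hx0)).2 ⟨x, hx, rfl⟩
    have hpos : ‖x‖ ≠ 0 := norm_ne_zero_iff.2 hx0
    simp only [real_inner_smul_right, real_inner_self_eq_norm_sq] at hle
    field_simp at hle
    exact hle
  · intro hx
    by_contra hxK
    obtain ⟨f, u, hf, hu⟩ := geometric_hahn_banach_closed_point hconv hclosed hxK
    obtain ⟨w, rfl⟩ := (InnerProductSpace.toDual ℝ E).surjective f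
    simp only [InnerProductSpace.toDual_apply_apply] at hf hu
    obtain ⟨k, hk⟩ := hne
    have hw : w ≠ 0 := by
      rintro rfl
      have := hf k hk
      simp only [inner_zero_left] at this hu
      linarith
    have hpos : 0 < ‖w‖ := norm_pos_iff.2 hw
    obtain ⟨m, hm, hmr⟩ := (h (‖w‖⁻¹ • w) (norm_smul_inv_norm (𝕜 := ℝ) hw)).1
    simp only [real_inner_smul_right] at hmr
    have hmw : ⟪w, m⟫ = ‖w‖ * r := by
      rw [← hmr, real_inner_comm, mul_inv_cancel_left₀ hpos.ne']
    have hxw : ⟪w, x⟫ ≤ ‖w‖ * r :=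
      (real_inner_le_norm w x).trans (mul_le_mul_of_nonneg_left hx hpos.le)
    linarith [hf m hm]

end SupportFunction

/-- Final geometric step in the proof of Theorem 1.1: a compact convex centrally
symmetric planar body of constant width `L` is the closed disk of radius `L/2`
centered at the origin. -/
theorem constant_width_centrally_symmetric_is_disk
    (K : Set (EuclideanSpace ℝ (Fin 2))) (hcpt : IsCompact K) (hconv : Convex ℝ K)
    (hint : (interior K).Nonempty) (hsym : ∀ x, x ∈ K ↔ -x ∈ K)
    (L : ℝ) (hL : 0 < L)
    (hwidth : ∀ ν : EuclideanSpace ℝ (Fin 2), ‖ν‖ = 1 →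
      sSup ((fun x => ⟪x, ν⟫) '' K) - sInf ((fun x => ⟪x, ν⟫) '' K) = L) :
    K = Metric.closedBall 0 (L / 2) := by
  have hne : K.Nonempty := hint.mono interior_subset
  refine hconv.eq_closedBall_of_isGreatest_inner hcpt.isClosed hne (by positivity) fun ν hν => ?_
  rw [← hwidth ν hν]
  exact hcpt.isGreatest_inner_half_width hne hsym ν
end
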